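/- Let n ≥ 3, t ≥ 1, and let j : Fin t → ℤ satisfy j s ≢ 0 (mod n) and 2·(j s) ≢ 0 (mod n) for all s, with X = GI(n;j) connected and vertex-transitive. Then there exists k₀ ≥ 1 such that for every s ∈ Fin t the number #{i ∈ Fin t : j i ≡ j s (mod n) or j i ≡ −j s (mod n)} equals k₀, and there exists a primitive function j₀ : Fin t₀ → ℤ with t = k₀·t₀ such that GI(n;j₀) is vertex-transitive and X is isomorphic to GI(n;[k₀]j₀). -/

import Mathlib

open SimpleGraph

/-- The GI-graph `GI(n; j)` on vertex set `Fin t × ZMod n`: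
`(s,v)` and `(s',v')` are adjacent iff `v = v'` and `s ≠ s'` (a spoke edge), or
`s = s'` and `v' = v + j s` or `v' = v - j s` in `ZMod n` (a layer edge). -/
def GI (n t : ℕ) (j : Fin t → ℤ) : SimpleGraph (Fin t × ZMod n) :=
  SimpleGraph.fromRel (fun x y =>
    (x.2 = y.2 ∧ x.1 ≠ y.1) ∨ (x.1 = y.1 ∧ y.2 = x.2 + (j x.1 : ZMod n)))

/-- A map on vertices respects the fundamental edge-partition of `GI(n;j)` if it maps
spoke edges to spoke edges and layer edges to layer edges. -/
def RespectsPart (n t : ℕ) (j : Fin t → ℤ) (f : Fin t × ZMod n → Fin t × ZMod n) : Prop :=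
  (∀ x y : Fin t × ZMod n, (GI n t j).Adj x y → x.2 = y.2 → (f x).2 = (f y).2) ∧
  (∀ x y : Fin t × ZMod n, (GI n t j).Adj x y → x.1 = y.1 → (f x).1 = (f y).1)

/-- The `k`-fold concatenation `[k]j` of the sequence `j`. -/
def rep (k t : ℕ) (j : Fin t → ℤ) : Fin (k * t) → ℤ :=
  fun s => j ⟨(s : ℕ) % t, Nat.mod_lt _ (by
    rcases Nat.eq_zero_or_pos t with ht | ht
    · exact absurd s.isLt (by simp [ht])
    · exact ht)⟩

/-- The sequence `j` is primitive (mod `n`): some `j s ≡ 1 (mod n)` and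
`j i ≢ ±j k (mod n)` whenever `i ≠ k`. -/
def PrimitiveSeq (n : ℕ) {t : ℕ} (j : Fin t → ℤ) : Prop :=
  (∃ s, (j s : ZMod n) = 1) ∧
  ∀ i k : Fin t, i ≠ k →
    (j i : ZMod n) ≠ (j k : ZMod n) ∧ (j i : ZMod n) ≠ -(j k : ZMod n)

/-- The set `J = {j s mod n : s}`. -/
def Jset (n : ℕ) {t : ℕ} (j : Fin t → ℤ) : Set (ZMod n) :=
  Set.range (fun s => ((j s : ZMod n)))

/-- The set `J ∪ -J`. -/
def JJset (n : ℕ) {t : ℕ} (j : Fin t → ℤ) : Set (ZMod n) :=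
  Jset n j ∪ (Neg.neg '' Jset n j)

/-- A graph is vertex-transitive if its automorphism group acts transitively on vertices. -/
def IsVertexTransitive {V : Type*} (G : SimpleGraph V) : Prop :=
  ∀ x y : V, ∃ φ : G ≃g G, φ x = y

/-- `H` is a group of automorphisms of `G` acting simply transitively (regularly)
on the vertices. -/
def IsRegularAutGroup {V : Type*} (G : SimpleGraph V) (H : Subgroup (Equiv.Perm V)) : Prop :=
  (∀ π ∈ H, ∀ x y : V, G.Adj x y ↔ G.Adj (π x) (π y)) ∧
  ∀ x y : V, ∃! π : Equiv.Perm V, π ∈ H ∧ π x = y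

/-- A graph is a Cayley graph iff its automorphism group has a subgroup acting
simply transitively (regularly) on the vertices. -/
def IsCayley {V : Type*} (G : SimpleGraph V) : Prop :=
  ∃ H : Subgroup (Equiv.Perm V), IsRegularAutGroup G H

/-- The standard rotation `ρ : (s,v) ↦ (s, v+1)` as a permutation of the vertices. -/
def rho (n t : ℕ) : Equiv.Perm (Fin t × ZMod n) :=
  Equiv.prodCongr (Equiv.refl (Fin t)) (Equiv.addRight (1 : ZMod n))

/-- The map `λ_{i,s₁,s₂}`, which swaps `(s₁,v)` and `(s₂,v)` whenever
`v ≡ i (mod gcd(n, j s₁))` (i.e. the image of `v` under the natural map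
`ZMod n → ZMod (gcd (n, j s₁))` equals `i mod gcd(n, j s₁)`), and fixes all other
vertices. -/
def lamMap (n t : ℕ) (j : Fin t → ℤ) (s₁ s₂ : Fin t) (i : ℤ) (x : Fin t × ZMod n) :
    Fin t × ZMod n :=
  if (ZMod.cast x.2 : ZMod (Int.gcd (n : ℤ) (j s₁))) =
      ((i : ℤ) : ZMod (Int.gcd (n : ℤ) (j s₁))) then
    if x.1 = s₁ then (s₂, x.2) else if x.1 = s₂ then (s₁, x.2) else x
  else x

namespace GIGraph

variable {n t t' : ℕ} {j : Fin t → ℤ} {j' : Fin t' → ℤ}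

lemma adj_iff {x y : Fin t × ZMod n} : (GI n t j).Adj x y ↔ x ≠ y ∧
    ((x.2 = y.2 ∧ x.1 ≠ y.1) ∨
      (x.1 = y.1 ∧ (y.2 = x.2 + (j x.1 : ZMod n) ∨ y.2 = x.2 - (j x.1 : ZMod n)))) := by
  rcases x with ⟨s, v⟩
  rcases y with ⟨s', v'⟩
  simp only [GI, fromRel_adj]
  refine and_congr_right fun _ => ⟨?_, ?_⟩
  · rintro ((h | ⟨h1, h2⟩) | (⟨h1, h2⟩ | ⟨h1, h2⟩))
    · exact Or.inl h
    · exact Or.inr ⟨h1, Or.inl h2⟩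
    · exact Or.inl ⟨h1.symm, h2.symm⟩
    · subst h1
      exact Or.inr ⟨rfl, Or.inr (by rw [h2]; ring)⟩
  · rintro (h | ⟨h1, h2 | h2⟩)
    · exact Or.inl (Or.inl h)
    · exact Or.inl (Or.inr ⟨h1, h2⟩)
    · subst h1
      exact Or.inr (Or.inr ⟨rfl, by rw [h2]; ring⟩)

lemma adj_spoke {s s' : Fin t} (h : s ≠ s') (v : ZMod n) :
    (GI n t j).Adj (s, v) (s', v) :=
  adj_iff.2 ⟨by simp [h], Or.inl ⟨rfl, h⟩⟩

lemma adj_layer_add {s : Fin t} (h : (j s : ZMod n) ≠ 0) (v : ZMod n) :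
    (GI n t j).Adj (s, v) (s, v + (j s : ZMod n)) :=
  adj_iff.2 ⟨by simpa using h, Or.inr ⟨rfl, Or.inl rfl⟩⟩

lemma adj_layer_sub {s : Fin t} (h : (j s : ZMod n) ≠ 0) (v : ZMod n) :
    (GI n t j).Adj (s, v) (s, v - (j s : ZMod n)) :=
  adj_iff.2 ⟨fun h' => h (by linear_combination (Prod.ext_iff.1 h').2), Or.inr ⟨rfl, Or.inr rfl⟩⟩

/-- The isomorphism `(s, v) ↦ (e s, u v + c)` of GI-graphs attached to a bijection `e` of the
layers and a unit `u` with `j' ∘ e = ± u j`. -/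
def affineIso (e : Fin t ≃ Fin t') (u : (ZMod n)ˣ) (c : ZMod n)
    (h : ∀ s, (j' (e s) : ZMod n) = u * (j s : ZMod n) ∨
      (j' (e s) : ZMod n) = -(u * (j s : ZMod n))) :
    GI n t j ≃g GI n t' j' where
  toEquiv := Equiv.prodCongr e (u.mulLeft.trans (Equiv.addRight c))
  map_rel_iff' := by
    rintro ⟨s, v⟩ ⟨s', v'⟩
    rw [adj_iff, adj_iff, (Equiv.injective _).ne_iff]
    refine and_congr_right fun _ => ?_
    have key : ∀ a b : ZMod n, (u : ZMod n) * a = u * b ↔ a = b := fun a b => u.mul_right_inj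
    have h1 : u * v' + c = u * v + c + u * (j s : ZMod n) ↔ v' = v + (j s : ZMod n) := by
      rw [← key v' (v + _), mul_add, add_right_comm, add_left_inj]
    have h2 : u * v' + c = u * v + c - u * (j s : ZMod n) ↔ v' = v - (j s : ZMod n) := by
      rw [← key v' (v - _), mul_sub, add_sub_right_comm, add_left_inj]
    simp only [Equiv.prodCongr_apply, Prod.map_apply, Equiv.trans_apply, Units.mulLeft_apply,
      Equiv.coe_addRight, EmbeddingLike.apply_eq_iff_eq, ne_eq, add_left_inj, key]
    rcases h s with hs | hs <;> rw [hs]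
    · rw [h1, h2]
    · rw [← sub_eq_add_neg, sub_neg_eq_add, h1, h2, or_comm (a := v' = v - _)]

lemma eq_zero_of_connected (hconn : (GI n t j).Connected) {A : Type*} [AddGroup A]
    (f : ZMod n →+ A) (hf : ∀ s, f (j s : ZMod n) = 0) (v : ZMod n) : f v = 0 := by
  obtain ⟨⟨s, w⟩⟩ := hconn.nonempty
  have hadj : ∀ x y, (GI n t j).Adj x y → f x.2 = f y.2 := by
    intro x y h
    rcases (adj_iff.1 h).2 with h | ⟨_, h | h⟩
    · rw [h.1]
    · rw [h, map_add, hf, add_zero]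
    · rw [h, map_sub, hf, sub_zero]
  have hwalk : ∀ x y, (GI n t j).Walk x y → f x.2 = f y.2 := by
    intro x y p
    induction p with
    | nil => rfl
    | cons h _ ih => exact (hadj _ _ h).trans ih
  obtain ⟨p⟩ := hconn.preconnected (s, v) (s, 0)
  simpa using hwalk _ _ p

lemma isUnit_of_mul_eq_zero [NeZero n] {a : ZMod n} (h : ∀ c : ZMod n, c * a = 0 → c = 0) :
    IsUnit a :=
  isUnit_iff_mem_nonZeroDivisors_of_finite.2 (mem_nonZeroDivisors_iff_right.2 h)

/-- Every automorphism of `GI(n; j)` maps layer edges to layer edges. -/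
def PreservesLayers (n t : ℕ) (j : Fin t → ℤ) : Prop :=
  ∀ φ : GI n t j ≃g GI n t j, ∀ x y, (GI n t j).Adj x y → x.1 = y.1 → (φ x).1 = (φ y).1

lemma PreservesLayers.spoke (hP : PreservesLayers n t j) (φ : GI n t j ≃g GI n t j)
    (s s' : Fin t) (v : ZMod n) : (φ (s, v)).2 = (φ (s', v)).2 := by
  by_cases hs : s = s'
  · rw [hs]
  have hadj := φ.map_adj_iff.2 (adj_spoke (j := j) hs v)
  rcases (adj_iff.1 hadj).2 with h | h
  · exact h.1
  · have := hP φ.symm _ _ hadj h.1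
    simp only [RelIso.symm_apply_apply] at this
    exact absurd this hs

lemma PreservesLayers.walk (hP : PreservesLayers n t j)
    (hj : ∀ s, (j s : ZMod n) ≠ 0 ∧ ((2 * j s : ℤ) : ZMod n) ≠ 0)
    (φ : GI n t j ≃g GI n t j) (s : Fin t) (v : ZMod n) :
    ∃ ε : ZMod n, (ε = 1 ∨ ε = -1) ∧ ∀ m : ℕ, φ (s, v + m * (j s : ZMod n)) =
      ((φ (s, v)).1, (φ (s, v)).2 + ε * (m * (j (φ (s, v)).1 : ZMod n))) := by
  set k : ZMod n := (j (φ (s, v)).1 : ZMod n) with hk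
  have step : ∀ w, (φ (s, w)).1 = (φ (s, v)).1 →
      (φ (s, w + (j s : ZMod n))).1 = (φ (s, v)).1 ∧
      ((φ (s, w + (j s : ZMod n))).2 = (φ (s, w)).2 + k ∨
       (φ (s, w + (j s : ZMod n))).2 = (φ (s, w)).2 - k) := by
    intro w hw
    have hadj := adj_layer_add (j := j) (hj s).1 w
    have h1 := hP φ _ _ hadj rfl
    refine ⟨h1 ▸ hw, ?_⟩
    rcases (adj_iff.1 (φ.map_adj_iff.2 hadj)).2 with h | h
    · exact absurd h1 h.2
    · rw [hk, ← hw]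
      exact h.2
  obtain ⟨ε, hε, h1⟩ : ∃ ε : ZMod n, (ε = 1 ∨ ε = -1) ∧
      φ (s, v + (j s : ZMod n)) = ((φ (s, v)).1, (φ (s, v)).2 + ε * k) := by
    obtain ⟨h, h' | h'⟩ := step v rfl
    · exact ⟨1, Or.inl rfl, Prod.ext h (by simp [h'])⟩
    · exact ⟨-1, Or.inr rfl, Prod.ext h (by simp [h', sub_eq_add_neg])⟩
  refine ⟨ε, hε, fun m => ?_⟩
  induction m using Nat.twoStepInduction with
  | zero => simp
  | one => simpa using h1
  | more m ih1 ih2 =>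
    have e1 : v + ((m + 2 : ℕ) : ZMod n) * (j s : ZMod n) =
        v + ((m + 1 : ℕ) : ZMod n) * (j s : ZMod n) + (j s : ZMod n) := by push_cast; ring
    have hne : φ (s, v + ((m + 2 : ℕ) : ZMod n) * (j s : ZMod n)) ≠
        φ (s, v + (m : ZMod n) * (j s : ZMod n)) := by
      rw [φ.injective.ne_iff]
      intro h
      apply (hj s).2
      have := (Prod.ext_iff.1 h).2
      push_cast at this ⊢
      linear_combination this
    obtain ⟨h, h'⟩ := step (v + ((m + 1 : ℕ) : ZMod n) * (j s : ZMod n)) (by rw [ih2])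
    rw [e1]
    rw [e1, ih1] at hne
    rw [ih2] at h'
    refine Prod.ext h ?_
    have hne' : (φ (s, v + ((m + 1 : ℕ) : ZMod n) * (j s : ZMod n) + (j s : ZMod n))).2 ≠
      (φ (s, v)).2 + ε * ((m : ZMod n) * k) := fun h2 => hne (Prod.ext h h2)
    rcases hε with rfl | rfl <;> rcases h' with h' | h'
    · rw [h']; push_cast; ring
    · exact absurd (by rw [h']; push_cast; ring) hne'
    · exact absurd (by rw [h']; push_cast; ring) hne'
    · rw [h']; push_cast; ring

lemma PreservesLayers.isUnit [NeZero n] (hP : PreservesLayers n t j)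
    (hj : ∀ s, (j s : ZMod n) ≠ 0 ∧ ((2 * j s : ℤ) : ZMod n) ≠ 0)
    (hconn : (GI n t j).Connected) (hvt : IsVertexTransitive (GI n t j)) (s : Fin t) :
    IsUnit (j s : ZMod n) := by
  refine isUnit_of_mul_eq_zero fun c hc => ?_
  rw [← mul_one c]
  refine eq_zero_of_connected hconn (AddMonoidHom.mulLeft c) (fun s' => ?_) 1
  obtain ⟨φ, hφ⟩ := hvt (s, 0) (s', 0)
  obtain ⟨ε, hε, h⟩ := hP.walk hj φ s 0
  have := h c.val
  rw [ZMod.natCast_zmod_val, hc, add_zero, hφ] at this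
  have := (Prod.ext_iff.1 this).2
  simp only [zero_add] at this
  rcases hε with rfl | rfl <;> simpa [eq_comm] using this

/-- For any two layers there is a unit multiplier permuting the `j s` up to sign that takes
the first layer to the second one. -/
def MultiplierTransitive (n : ℕ) {t : ℕ} (j : Fin t → ℤ) : Prop :=
  ∀ s s' : Fin t, ∃ (π : Equiv.Perm (Fin t)) (u : (ZMod n)ˣ), π s = s' ∧
    ∀ i, (j (π i) : ZMod n) = u * (j i : ZMod n) ∨ (j (π i) : ZMod n) = -(u * (j i : ZMod n))

lemma PreservesLayers.multiplierTransitive [NeZero n] (hP : PreservesLayers n t j)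
    (hj : ∀ s, (j s : ZMod n) ≠ 0 ∧ ((2 * j s : ℤ) : ZMod n) ≠ 0)
    (hu : ∀ s, IsUnit (j s : ZMod n)) (hvt : IsVertexTransitive (GI n t j)) :
    MultiplierTransitive n j := by
  intro s s'
  obtain ⟨φ, hφ⟩ := hvt (s, 0) (s', 0)
  have h0 : ∀ i, (φ (i, 0)).2 = 0 := fun i => by rw [hP.spoke φ i s, hφ]
  have hinj : Function.Injective fun i : Fin t => (φ (i, 0)).1 := by
    intro i k hik
    have := φ.injective (Prod.ext hik ((h0 i).trans (h0 k).symm))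
    exact (Prod.ext_iff.1 this).1
  have key : ∀ i, (j (φ (i, 0)).1 : ZMod n) = (φ (s, 1)).2 * (j i : ZMod n) ∨
      (j (φ (i, 0)).1 : ZMod n) = -((φ (s, 1)).2 * (j i : ZMod n)) := by
    intro i
    obtain ⟨ε, hε, h⟩ := hP.walk hj φ i 0
    obtain ⟨b, hb⟩ := (hu i).exists_left_inv
    have := (Prod.ext_iff.1 (h b.val)).2
    rw [ZMod.natCast_zmod_val, hb, zero_add, hP.spoke φ i s, h0, zero_add] at this
    rw [this]
    rcases hε with rfl | rfl
    · left
      linear_combination -(j (φ (i, 0)).1 : ZMod n) * hb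
    · right
      linear_combination -(j (φ (i, 0)).1 : ZMod n) * hb
  have hunit : IsUnit (φ (s, 1)).2 := by
    have h1 := hu (φ (s, 0)).1
    rcases key s with h | h
    · rw [h] at h1
      exact isUnit_of_mul_isUnit_left h1
    · rw [h] at h1
      exact isUnit_of_mul_isUnit_left ((IsUnit.neg_iff _).1 h1)
  refine ⟨Equiv.ofBijective _ (Finite.injective_iff_bijective.1 hinj), hunit.unit, ?_, ?_⟩
  · simp [hφ]
  · simpa using key

lemma isVertexTransitive_of_multiplierTransitive (h : MultiplierTransitive n j) :
    IsVertexTransitive (GI n t j) := by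
  rintro ⟨s, v⟩ ⟨s', v'⟩
  obtain ⟨π, u, hs, hπ⟩ := h s s'
  refine ⟨affineIso π u (v' - u * v) hπ, ?_⟩
  change (π s, u * v + (v' - u * v)) = (s', v')
  rw [hs, add_sub_cancel]

lemma IsVertexTransitive.of_iso {V W : Type*} {G : SimpleGraph V} {H : SimpleGraph W}
    (e : G ≃g H) (hG : IsVertexTransitive G) : IsVertexTransitive H := by
  intro x y
  obtain ⟨φ, hφ⟩ := hG (e.symm x) (e.symm y)
  exact ⟨(e.symm.trans φ).trans e, by simp [hφ]⟩

lemma rep_finProdFinEquiv (k t₀ : ℕ) (j₀ : Fin t₀ → ℤ) (a : Fin k) (b : Fin t₀) :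
    rep k t₀ j₀ (finProdFinEquiv (a, b)) = j₀ b := by
  unfold rep
  congr 1
  ext
  simp [Nat.mod_eq_of_lt b.isLt]

/-- The equivalence relation on layers identifying `i` and `k` when `j i = ± j k`. -/
def layerSetoid (n : ℕ) {t : ℕ} (j : Fin t → ℤ) : Setoid (Fin t) where
  r i k := (j i : ZMod n) = (j k : ZMod n) ∨ (j i : ZMod n) = -(j k : ZMod n)
  iseqv :=
    { refl := fun _ => Or.inl rfl
      symm := by
        rintro i k (h | h)
        · exact Or.inl h.symm
        · exact Or.inr (by rw [h, neg_neg])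
      trans := by
        rintro i k l (h | h) (h' | h')
        · exact Or.inl (h.trans h')
        · exact Or.inr (h.trans h')
        · exact Or.inr (by rw [h, h'])
        · exact Or.inl (by rw [h, h', neg_neg]) }

lemma MultiplierTransitive.rel_iff {π : Equiv.Perm (Fin t)} {u : (ZMod n)ˣ}
    (hπ : ∀ i, (j (π i) : ZMod n) = u * (j i : ZMod n) ∨
      (j (π i) : ZMod n) = -(u * (j i : ZMod n))) (i k : Fin t) :
    layerSetoid n j (π i) (π k) ↔ layerSetoid n j i k := by
  have key : ∀ a b : ZMod n, (u : ZMod n) * a = u * b ↔ a = b := fun a b => u.mul_right_inj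
  have key' : ∀ a b : ZMod n, (u : ZMod n) * a = -(u * b) ↔ a = -b := fun a b => by
    rw [← mul_neg, key]
  change (_ ∨ _) ↔ (_ ∨ _)
  rcases hπ i with hi | hi <;> rcases hπ k with hk | hk <;> rw [hi, hk]
  · rw [key, key']
  · rw [neg_neg, key, key', or_comm]
  · rw [neg_inj, neg_eq_iff_eq_neg, key, key', or_comm]
  · rw [neg_inj, neg_inj, key, key']

/-- The conclusion of the structure theorem for `GI(n; j)`. -/
def HasPrimitiveRoot (n t : ℕ) (j : Fin t → ℤ) : Prop :=
  ∃ k₀ : ℕ, 1 ≤ k₀ ∧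
    (∀ s : Fin t,
      (Finset.univ.filter (fun i => (j i : ZMod n) = (j s : ZMod n) ∨
        (j i : ZMod n) = -((j s : ZMod n)))).card = k₀) ∧
    ∃ t₀ : ℕ, ∃ j₀ : Fin t₀ → ℤ, t = k₀ * t₀ ∧ PrimitiveSeq n j₀ ∧
      IsVertexTransitive (GI n t₀ j₀) ∧
      Nonempty (GI n t j ≃g GI n (k₀ * t₀) (rep k₀ t₀ j₀))

lemma MultiplierTransitive.card_eq (h : MultiplierTransitive n j) (s s' : Fin t) :
    (Finset.univ.filter (fun i => (j i : ZMod n) = (j s : ZMod n) ∨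
      (j i : ZMod n) = -((j s : ZMod n)))).card =
    (Finset.univ.filter (fun i => (j i : ZMod n) = (j s' : ZMod n) ∨
      (j i : ZMod n) = -((j s' : ZMod n)))).card := by
  obtain ⟨π, u, rfl, hπ⟩ := h s s'
  refine Finset.card_equiv π fun i => ?_
  simp only [Finset.mem_filter, Finset.mem_univ, true_and]
  exact (MultiplierTransitive.rel_iff hπ i s).symm

lemma MultiplierTransitive.hasPrimitiveRoot [NeZero n] (ht : 1 ≤ t)
    (h : MultiplierTransitive n j) (hu : ∀ s, IsUnit (j s : ZMod n)) :
    HasPrimitiveRoot n t j := by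
  classical
  let r := layerSetoid n j
  let o : Quotient r → Fin t := Quotient.out
  have ho : ∀ q, (Quotient.mk r (o q)) = q := Quotient.out_eq
  have ho' : ∀ i, r (o ⟦i⟧) i := fun i => Quotient.mk_out i
  let s₀ : Fin t := ⟨0, ht⟩
  let k₀ := (Finset.univ.filter (fun i => (j i : ZMod n) = (j s₀ : ZMod n) ∨
      (j i : ZMod n) = -((j s₀ : ZMod n)))).card
  have hcard := fun s => h.card_eq s s₀
  let eQ : Quotient r ≃ Fin (Fintype.card (Quotient r)) := Fintype.equivFin _
  have hfib : ∀ q : Quotient r, Nonempty ({i : Fin t // Quotient.mk r i = q} ≃ Fin k₀) := by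
    intro q
    refine ⟨Fintype.equivFinOfCardEq ?_⟩
    rw [Fintype.card_subtype]
    refine Eq.trans ?_ (hcard (o q))
    congr 1
    ext i
    simp only [Finset.mem_filter, Finset.mem_univ, true_and]
    rw [← ho q, Quotient.eq, ho]
    rfl
  let efib := fun q => (hfib q).some
  let e : Fin t ≃ Fin k₀ × Fin (Fintype.card (Quotient r)) :=
    (((Equiv.sigmaFiberEquiv (Quotient.mk r)).symm.trans (Equiv.sigmaCongrRight efib)).trans
      (Equiv.sigmaEquivProd _ _)).trans ((Equiv.prodComm _ _).trans
        (Equiv.prodCongr (Equiv.refl _) eQ))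
  have he : ∀ i, (e i).2 = eQ ⟦i⟧ := fun i => rfl
  obtain ⟨c, hc⟩ := (hu (o ⟦s₀⟧))
  let j₀ : Fin (Fintype.card (Quotient r)) → ℤ := fun b =>
    ((((c⁻¹ : (ZMod n)ˣ) : ZMod n) * (j (o (eQ.symm b)) : ZMod n)).val : ℤ)
  have hj₀ : ∀ b, (j₀ b : ZMod n) =
      ((c⁻¹ : (ZMod n)ˣ) : ZMod n) * (j (o (eQ.symm b)) : ZMod n) := fun b => by
    simp only [j₀, Int.cast_natCast, ZMod.natCast_zmod_val]
  refine ⟨k₀, ?_, hcard, _, j₀, ?_, ⟨⟨eQ ⟦s₀⟧, ?_⟩, ?_⟩, ?_, ?_⟩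
  · exact Finset.card_pos.2 ⟨s₀, by simp⟩
  · simpa using Fintype.card_congr e
  · rw [hj₀, Equiv.symm_apply_apply, ← hc, Units.inv_mul]
  · intro b b' hb
    have hn : ¬ r (o (eQ.symm b)) (o (eQ.symm b')) := by
      intro hr
      apply hb
      have := Quotient.sound hr
      rwa [ho, ho, eQ.symm.injective.eq_iff] at this
    rw [hj₀, hj₀, ← mul_neg]
    exact ⟨fun h' => hn (Or.inl ((Units.mul_right_inj _).1 h')),
      fun h' => hn (Or.inr ((Units.mul_right_inj _).1 h'))⟩
  · apply isVertexTransitive_of_multiplierTransitive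
    intro b b'
    obtain ⟨π, u, hπs, hπ⟩ := h (o (eQ.symm b)) (o (eQ.symm b'))
    let π' : Fin (Fintype.card (Quotient r)) → Fin (Fintype.card (Quotient r)) :=
      fun b => eQ ⟦π (o (eQ.symm b))⟧
    have hinj : Function.Injective π' := by
      intro b b' hb
      have h1 := (MultiplierTransitive.rel_iff hπ _ _).1 (Quotient.exact (eQ.injective hb))
      have := Quotient.sound h1
      rwa [ho, ho, eQ.symm.injective.eq_iff] at this
    refine ⟨Equiv.ofBijective π' (Finite.injective_iff_bijective.1 hinj), u, ?_, fun i => ?_⟩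
    · change eQ ⟦π (o (eQ.symm b))⟧ = b'
      rw [hπs, ho, Equiv.apply_symm_apply]
    · change (j₀ (eQ ⟦π (o (eQ.symm i))⟧) : ZMod n) = _ ∨
        (j₀ (eQ ⟦π (o (eQ.symm i))⟧) : ZMod n) = _
      rw [hj₀, hj₀, Equiv.symm_apply_apply]
      rcases ho' (π (o (eQ.symm i))) with h1 | h1 <;> rcases hπ (o (eQ.symm i)) with h2 | h2 <;>
        rw [h1, h2]
      · exact Or.inl (by ring)
      · exact Or.inr (by ring)
      · exact Or.inr (by ring)
      · exact Or.inl (by ring)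
  · refine ⟨affineIso (e.trans finProdFinEquiv) c⁻¹ 0 fun i => ?_⟩
    have : rep k₀ _ j₀ ((e.trans finProdFinEquiv) i) = j₀ (eQ ⟦i⟧) := by
      rw [← he, ← rep_finProdFinEquiv k₀ _ j₀ (e i).1]
      rfl
    rw [this, hj₀, Equiv.symm_apply_apply]
    rcases ho' i with h1 | h1 <;> rw [h1]
    · exact Or.inl rfl
    · exact Or.inr (by ring)

lemma hasPrimitiveRoot_of_forall_eq_or_neg [NeZero n] (ht : 1 ≤ t)
    (hconn : (GI n t j).Connected)
    (h : ∀ s s', (j s : ZMod n) = (j s' : ZMod n) ∨ (j s : ZMod n) = -(j s' : ZMod n)) :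
    HasPrimitiveRoot n t j := by
  refine MultiplierTransitive.hasPrimitiveRoot ht (fun s s' => ?_) fun s => ?_
  · exact ⟨Equiv.swap s s', 1, Equiv.swap_apply_left _ _, fun i => by simpa using h _ i⟩
  · refine isUnit_of_mul_eq_zero fun c hc => ?_
    rw [← mul_one c]
    refine eq_zero_of_connected hconn (AddMonoidHom.mulLeft c) (fun s' => ?_) 1
    rcases h s' s with h | h <;> simp [h, hc]

/-- A sequence without repetitions up to sign that contains a unit is primitive
up to rescaling. -/
lemma hasPrimitiveRoot_of_injective [NeZero n] (hvt : IsVertexTransitive (GI n t j))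
    (hinj : ∀ i k, i ≠ k → (j i : ZMod n) ≠ (j k : ZMod n) ∧ (j i : ZMod n) ≠ -(j k : ZMod n))
    {s : Fin t} (hs : IsUnit (j s : ZMod n)) : HasPrimitiveRoot n t j := by
  obtain ⟨c, hc⟩ := hs
  let j₀ : Fin t → ℤ := fun b => ((((c⁻¹ : (ZMod n)ˣ) : ZMod n) * (j b : ZMod n)).val : ℤ)
  have hj₀ : ∀ b, (j₀ b : ZMod n) = ((c⁻¹ : (ZMod n)ˣ) : ZMod n) * (j b : ZMod n) := fun b => by
    simp only [j₀, Int.cast_natCast, ZMod.natCast_zmod_val]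
  refine ⟨1, le_rfl, fun s => ?_, t, j₀, (one_mul t).symm, ⟨⟨s, ?_⟩, ?_⟩, ?_, ?_⟩
  · rw [Finset.card_eq_one]
    refine ⟨s, ?_⟩
    ext i
    simp only [Finset.mem_filter, Finset.mem_univ, true_and, Finset.mem_singleton]
    refine ⟨fun h => ?_, fun h => Or.inl (by rw [h])⟩
    by_contra hne
    exact h.elim (hinj i s hne).1 (hinj i s hne).2
  · rw [hj₀, ← hc, Units.inv_mul]
  · intro b b' hb
    rw [hj₀, hj₀, ← mul_neg, ne_eq, ne_eq, Units.mul_right_inj, Units.mul_right_inj]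
    exact hinj b b' hb
  · exact IsVertexTransitive.of_iso
      (affineIso (Equiv.refl _) c⁻¹ 0 fun i => Or.inl (hj₀ i)) hvt
  · refine ⟨affineIso (finCongr (one_mul t).symm) c⁻¹ 0 fun i => Or.inl ?_⟩
    rw [← hj₀]
    simp [rep, Nat.mod_eq_of_lt i.isLt]

lemma preservesLayers_of_invariant (P : Fin t × ZMod n → Fin t × ZMod n → Prop)
    (hinv : ∀ (φ : GI n t j ≃g GI n t j) (x y), P x y → P (φ x) (φ y))
    (hP : ∀ x y, (GI n t j).Adj x y → (P x y ↔ x.1 ≠ y.1)) : PreservesLayers n t j := by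
  intro φ x y hxy hl
  by_contra hne
  have h := hinv φ.symm _ _ ((hP _ _ (φ.map_adj_iff.2 hxy)).2 hne)
  simp only [RelIso.symm_apply_apply] at h
  exact (hP _ _ hxy).1 h hl

lemma layer_commonNeighbor {x y z : Fin t × ZMod n} (hxy : (GI n t j).Adj x y)
    (hl : x.1 = y.1) (hxz : (GI n t j).Adj x z) (hyz : (GI n t j).Adj y z) :
    z = (x.1, 2 * x.2 - y.2) ∧ 3 * (j x.1 : ZMod n) = 0 := by
  rcases x with ⟨s, v⟩
  rcases y with ⟨s', w⟩
  rcases z with ⟨s'', u⟩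
  simp only [adj_iff, ne_eq, Prod.mk.injEq, not_and] at *
  subst hl
  have hvw : v ≠ w := hxy.1 rfl
  rcases hxz with ⟨h1, ⟨h2, h3⟩ | ⟨rfl, h2⟩⟩
  · rcases hyz with ⟨h4, ⟨h5, h6⟩ | ⟨rfl, h5⟩⟩
    · exact absurd (h2.trans h5.symm) hvw
    · exact absurd rfl h3
  rcases hyz with ⟨h4, ⟨h5, h6⟩ | ⟨-, h5⟩⟩
  · exact absurd rfl h6
  have h1 := h1 rfl
  have h4 := h4 rfl
  have h6 := hxy.2.resolve_left fun h => h.2 rfl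
  obtain ⟨-, h6⟩ := h6
  generalize (j s : ZMod n) = a at *
  rcases h2 with rfl | rfl <;> rcases h6 with rfl | rfl
  · exact absurd rfl h4
  · rcases h5 with h5 | h5
    · exact absurd (by linear_combination h5) hvw
    · exact ⟨⟨rfl, by ring⟩, by linear_combination h5⟩
  · rcases h5 with h5 | h5
    · exact ⟨⟨rfl, by ring⟩, by linear_combination -h5⟩
    · exact absurd (by linear_combination h5) hvw
  · exact absurd rfl h4

lemma preservesLayers_of_three_mul_ne_zero (ht : 3 ≤ t)
    (h3 : ∀ s, 3 * (j s : ZMod n) ≠ 0) : PreservesLayers n t j := by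
  refine preservesLayers_of_invariant
    (fun x y => ∃ z, (GI n t j).Adj x z ∧ (GI n t j).Adj y z) ?_ ?_
  · rintro φ x y ⟨z, h1, h2⟩
    exact ⟨φ z, φ.map_adj_iff.2 h1, φ.map_adj_iff.2 h2⟩
  · intro x y hxy
    constructor
    · rintro ⟨z, h1, h2⟩ hl
      exact h3 _ (layer_commonNeighbor hxy hl h1 h2).2
    · intro hne
      have hv : x.2 = y.2 := ((adj_iff.1 hxy).2.resolve_right fun h => hne h.1).1
      rcases x with ⟨s, v⟩
      rcases y with ⟨s', w⟩
      subst hv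
      have hc : 0 < (({s, s'} : Finset (Fin t))ᶜ).card := by
        rw [Finset.card_compl, Fintype.card_fin]
        have := Finset.card_le_two (a := s) (b := s')
        omega
      obtain ⟨a, ha⟩ := Finset.card_pos.1 hc
      simp only [Finset.mem_compl, Finset.mem_insert, Finset.mem_singleton, not_or] at ha
      exact ⟨(a, v), adj_spoke (Ne.symm ha.1) v, adj_spoke (Ne.symm ha.2) v⟩

/-- In a vertex-transitive graph `GI(n; j)` with at least three layers, triangular layers
occur only if all layers are triangular. -/
lemma three_mul_eq_zero_of_exists (ht : 3 ≤ t)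
    (hj : ∀ s, (j s : ZMod n) ≠ 0) (hvt : IsVertexTransitive (GI n t j))
    {s : Fin t} (hs : 3 * (j s : ZMod n) = 0) (s' : Fin t) : 3 * (j s' : ZMod n) = 0 := by
  obtain ⟨φ, hφ⟩ := hvt (s', 0) (s, 0)
  have hall : ∀ y, (GI n t j).Adj (s, 0) y →
      ∃ z, (GI n t j).Adj (s, 0) z ∧ (GI n t j).Adj y z := by
    rintro ⟨a, w⟩ h
    rcases (adj_iff.1 h).2 with ⟨h1, h2⟩ | ⟨h1, h2⟩
    · have hc : 0 < (({s, a} : Finset (Fin t))ᶜ).card := by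
        rw [Finset.card_compl, Fintype.card_fin]
        have := Finset.card_le_two (a := s) (b := a)
        omega
      obtain ⟨b, hb⟩ := Finset.card_pos.1 hc
      simp only [Finset.mem_compl, Finset.mem_insert, Finset.mem_singleton, not_or] at hb
      simp only at h1
      subst h1
      exact ⟨(b, 0), adj_spoke (Ne.symm hb.1) 0, adj_spoke (Ne.symm hb.2) 0⟩
    · simp only [zero_add, zero_sub] at h1 h2
      subst h1
      rcases h2 with rfl | rfl
      · refine ⟨(s, 0 - (j s : ZMod n)), adj_layer_sub (hj s) 0, ?_⟩
        convert adj_layer_add (j := j) (hj s) (j s : ZMod n) using 2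
        linear_combination -hs
      · refine ⟨(s, 0 + (j s : ZMod n)), adj_layer_add (hj s) 0, ?_⟩
        convert adj_layer_sub (j := j) (hj s) (-(j s : ZMod n)) using 2
        linear_combination hs
  have hadj := adj_layer_add (j := j) (hj s') 0
  obtain ⟨z, h1, h2⟩ := hall _ (hφ ▸ φ.map_adj_iff.2 hadj)
  have h1' := φ.symm.map_adj_iff.2 h1
  have h2' := φ.symm.map_adj_iff.2 h2
  rw [← hφ] at h1'
  simp only [RelIso.symm_apply_apply] at h1' h2'
  exact (layer_commonNeighbor hadj rfl h1' h2').2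

lemma eq_or_eq_neg_of_three_mul_eq_zero (hn : 3 ≤ n) (hconn : (GI n t j).Connected)
    (hj : ∀ s, (j s : ZMod n) ≠ 0) (h3 : ∀ s, 3 * (j s : ZMod n) = 0) (s s' : Fin t) :
    (j s : ZMod n) = (j s' : ZMod n) ∨ (j s : ZMod n) = -(j s' : ZMod n) := by
  have h := eq_zero_of_connected hconn (AddMonoidHom.mulLeft (3 : ZMod n)) h3 1
  simp only [AddMonoidHom.coe_mulLeft, mul_one] at h
  have hdvd : n ∣ 3 := (ZMod.natCast_eq_zero_iff 3 n).1 (by exact_mod_cast h)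
  obtain rfl : n = 3 := le_antisymm (Nat.le_of_dvd (by norm_num) hdvd) hn
  have key : ∀ a b : ZMod 3, a ≠ 0 → b ≠ 0 → a = b ∨ a = -b := by decide
  exact key _ _ (hj s) (hj s')

section TwoLayers

variable {j : Fin 2 → ℤ}

/-- The three neighbours of a vertex of an I-graph; directions `0`, `1` are the layer edges and
`2` is the spoke. -/
def step (j : Fin 2 → ℤ) (x : Fin 2 × ZMod n) (d : Fin 3) : Fin 2 × ZMod n :=
  if d = 0 then (x.1, x.2 + (j x.1 : ZMod n))
  else if d = 1 then (x.1, x.2 - (j x.1 : ZMod n))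
  else (x.1 + 1, x.2)

lemma exists_step {x y : Fin 2 × ZMod n} (h : (GI n 2 j).Adj x y) : ∃ d, y = step j x d := by
  rcases (adj_iff.1 h).2 with ⟨h1, h2⟩ | ⟨h1, h2 | h2⟩
  · refine ⟨2, Prod.ext ?_ h1.symm⟩
    have key : ∀ a b : Fin 2, a ≠ b → b = a + 1 := by decide
    exact key _ _ h2
  · exact ⟨0, Prod.ext h1.symm h2⟩
  · exact ⟨1, Prod.ext h1.symm h2⟩

/-- Two directions are mutually inverse exactly when they add up to `1`. -/
lemma step_step (x : Fin 2 × ZMod n) {d d' : Fin 3} (h : d + d' = 1) :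
    step j (step j x d) d' = x := by
  have key : ∀ d d' : Fin 3, d + d' = 1 →
      (d = 0 ∧ d' = 1) ∨ (d = 1 ∧ d' = 0) ∨ (d = 2 ∧ d' = 2) := by decide
  have key' : ∀ a : Fin 2, a + 1 + 1 = a := by decide
  rcases key d d' h with ⟨rfl, rfl⟩ | ⟨rfl, rfl⟩ | ⟨rfl, rfl⟩
  · simp [step]
  · simp [step]
  · simp [step, key']

/-- Symbolic version of `step`: `(σ, α, β)` stands for the vertex reached from `(s, v)` by
changing layers `σ` times and moving by `α * j s + β * j (s + 1)`. -/
def move (x : Fin 2 × ℤ × ℤ) (d : Fin 3) : Fin 2 × ℤ × ℤ :=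
  if d = 2 then (x.1 + 1, x.2.1, x.2.2)
  else if x.1 = 0 then (x.1, (if d = 0 then x.2.1 + 1 else x.2.1 - 1), x.2.2)
  else (x.1, x.2.1, if d = 0 then x.2.2 + 1 else x.2.2 - 1)

/-- The vertex described by a symbolic position relative to `(s, v)`. -/
def place (j : Fin 2 → ℤ) (s : Fin 2) (v : ZMod n) (x : Fin 2 × ℤ × ℤ) : Fin 2 × ZMod n :=
  (s + x.1, v + x.2.1 * (j s : ZMod n) + x.2.2 * (j (s + 1) : ZMod n))

lemma step_place (s : Fin 2) (v : ZMod n) (x : Fin 2 × ℤ × ℤ) (d : Fin 3) :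
    step j (place j s v x) d = place j s v (move x d) := by
  obtain ⟨σ, α, β⟩ := x
  have hd : d = 0 ∨ d = 1 ∨ d = 2 := by revert d; decide
  have hσ : σ = 0 ∨ σ = 1 := by revert σ; decide
  rcases hσ with rfl | rfl <;> rcases hd with rfl | rfl | rfl <;>
    simp [step, place, move, add_assoc] <;> ring

/-- `z` is the third vertex of a closed non-backtracking walk of length eight starting with
the arc `(x, y)`. -/
def IsThird (n : ℕ) (j : Fin 2 → ℤ) (x y z : Fin 2 × ZMod n) : Prop :=
  ∃ a b c d e, ((GI n 2 j).Adj x y ∧ (GI n 2 j).Adj y z ∧ (GI n 2 j).Adj z a ∧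
    (GI n 2 j).Adj a b ∧ (GI n 2 j).Adj b c ∧ (GI n 2 j).Adj c d ∧ (GI n 2 j).Adj d e ∧
    (GI n 2 j).Adj e x) ∧ z ≠ x ∧ a ≠ y ∧ b ≠ z ∧ c ≠ a ∧ d ≠ b ∧ e ≠ c ∧ x ≠ d ∧ y ≠ e

lemma IsThird.map (φ : GI n 2 j ≃g GI n 2 j) {x y z : Fin 2 × ZMod n} (h : IsThird n j x y z) :
    IsThird n j (φ x) (φ y) (φ z) := by
  obtain ⟨a, b, c, d, e, ha, hb⟩ := h
  refine ⟨φ a, φ b, φ c, φ d, φ e, ?_⟩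
  simpa only [SimpleGraph.Iso.map_adj_iff, φ.injective.ne_iff] using And.intro ha hb

set_option maxRecDepth 100000 in
lemma move_closed : ∀ d₀ : Fin 3, d₀ ≠ 2 → ∀ d₁, d₁ ≠ 2 → d₀ + d₁ ≠ 1 → ∀ d₂, d₁ + d₂ ≠ 1 →
    ∀ d₃, d₂ + d₃ ≠ 1 → ∀ d₄, d₃ + d₄ ≠ 1 → ∀ d₅, d₄ + d₅ ≠ 1 → ∀ d₆, d₅ + d₆ ≠ 1 →
    ∀ d₇, d₆ + d₇ ≠ 1 → d₇ + d₀ ≠ 1 →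
    ([d₀, d₁, d₂, d₃, d₄, d₅, d₆, d₇].foldl move (0, 0, 0)).1 = 0 →
    ([d₀, d₁, d₂, d₃, d₄, d₅, d₆, d₇].foldl move (0, 0, 0)).2 ∈
      ([(8, 0), (-8, 0)] : List (ℤ × ℤ)) ∨
    (([d₀, d₁, d₂, d₃, d₄, d₅, d₆, d₇].foldl move (0, 0, 0)).2.1.natAbs,
      ([d₀, d₁, d₂, d₃, d₄, d₅, d₆, d₇].foldl move (0, 0, 0)).2.2.natAbs) ∈
      ([(1, 5), (2, 4), (3, 3), (4, 2), (5, 1)] : List (ℕ × ℕ)) := by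
  decide

lemma IsThird.fst_ne {p q : ℕ} (hp : p.Prime) (hq : q.Prime) (hpn : p ∣ n) (hqn : q ∣ n)
    {s : Fin 2} (hps : (p : ℤ) ∣ j s) (hps' : ¬ (p : ℤ) ∣ j (s + 1)) (hqs : ¬ (q : ℤ) ∣ j s)
    (hqs' : (q : ℤ) ∣ j (s + 1)) (h8 : 8 * (j s : ZMod n) ≠ 0) {v : ZMod n}
    {y z : Fin 2 × ZMod n} (hy : y.1 = s) (h : IsThird n j (s, v) y z) : z.1 ≠ s := by
  intro hz
  obtain ⟨a, b, c, d, e, ⟨h0, h1, h2, h3, h4, h5, h6, h7⟩, n0, n1, n2, n3, n4, n5, n6, n7⟩ := h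
  have hne : ∀ a : Fin 2, a + 1 ≠ a := by decide
  obtain ⟨d₀, rfl⟩ := exists_step h0
  obtain ⟨d₁, rfl⟩ := exists_step h1
  obtain ⟨d₂, rfl⟩ := exists_step h2
  obtain ⟨d₃, rfl⟩ := exists_step h3
  obtain ⟨d₄, rfl⟩ := exists_step h4
  obtain ⟨d₅, rfl⟩ := exists_step h5
  obtain ⟨d₆, rfl⟩ := exists_step h6
  obtain ⟨d₇, hd₇⟩ := exists_step h7
  have hd₀ : d₀ ≠ 2 := by
    rintro rfl
    exact hne s hy
  have hd₁ : d₁ ≠ 2 := by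
    rintro rfl
    exact hne s ((congrArg (· + 1) hy).symm.trans hz)
  have hd₇₀ : d₇ + d₀ ≠ 1 := by
    intro h
    apply n7
    conv_lhs => rw [hd₇]
    exact step_step _ h
  have hplace : ((s, v) : Fin 2 × ZMod n) = place j s v (0, 0, 0) := by simp [place]
  have hd₆₇ : d₆ + d₇ ≠ 1 := fun h => n6 (hd₇.trans (step_step _ h))
  have key := move_closed d₀ hd₀ d₁ hd₁ (fun h => n0 (step_step _ h))
    d₂ (fun h => n1 (step_step _ h)) d₃ (fun h => n2 (step_step _ h))
    d₄ (fun h => n3 (step_step _ h)) d₅ (fun h => n4 (step_step _ h))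
    d₆ (fun h => n5 (step_step _ h)) d₇ hd₆₇ hd₇₀
  have hclose : ((s, v) : Fin 2 × ZMod n) =
      place j s v ([d₀, d₁, d₂, d₃, d₄, d₅, d₆, d₇].foldl move (0, 0, 0)) := by
    conv_lhs => rw [hd₇, hplace]
    simp only [step_place, List.foldl_cons, List.foldl_nil]
  generalize [d₀, d₁, d₂, d₃, d₄, d₅, d₆, d₇].foldl move (0, 0, 0) = w at key hclose
  obtain ⟨σ, α, β⟩ := w
  have hσ : σ = 0 := by simpa [place] using (Prod.ext_iff.1 hclose).1
  have hsum : ((α * j s + β * j (s + 1) : ℤ) : ZMod n) = 0 := by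
    have := (Prod.ext_iff.1 hclose).2
    simp only [place] at this
    push_cast
    linear_combination -this
  rw [ZMod.intCast_zmod_eq_zero_iff_dvd] at hsum
  have hpβ : p ∣ β.natAbs := by
    have h := (Int.natCast_dvd_natCast.2 hpn).trans hsum
    have h := (dvd_add_right (hps.mul_left α)).1 h
    exact Int.natCast_dvd.1 (((Nat.prime_iff_prime_int.1 hp).dvd_or_dvd h).resolve_right hps')
  have hqα : q ∣ α.natAbs := by
    have h := (Int.natCast_dvd_natCast.2 hqn).trans hsum
    have h := (dvd_add_left (hqs'.mul_left β)).1 h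
    exact Int.natCast_dvd.1 (((Nat.prime_iff_prime_int.1 hq).dvd_or_dvd h).resolve_right hqs)
  have hpq : p ≠ q := by
    rintro rfl
    exact hqs hps
  have hp2 := hp.two_le
  have hq2 := hq.two_le
  rcases key hσ with h | h
  · have h8' : ((8 * j s : ℤ) : ZMod n) = 0 := by
      rw [ZMod.intCast_zmod_eq_zero_iff_dvd]
      simp only [List.mem_cons, Prod.mk.injEq, List.not_mem_nil, or_false] at h
      rcases h with ⟨rfl, rfl⟩ | ⟨rfl, rfl⟩
      · simpa using hsum
      · simpa using hsum
    exact h8 (by exact_mod_cast h8')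
  · simp only [List.mem_cons, Prod.mk.injEq, List.not_mem_nil, or_false] at h
    have hp4 : p ∣ 2 * 2 → p = 2 := fun h => by
      rcases hp.dvd_mul.1 h with h | h <;> exact (Nat.prime_dvd_prime_iff_eq hp Nat.prime_two).1 h
    have hq4 : q ∣ 2 * 2 → q = 2 := fun h => by
      rcases hq.dvd_mul.1 h with h | h <;> exact (Nat.prime_dvd_prime_iff_eq hq Nat.prime_two).1 h
    rcases h with ⟨h, h'⟩ | ⟨h, h'⟩ | ⟨h, h'⟩ | ⟨h, h'⟩ | ⟨h, h'⟩ <;>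
      rw [h] at hqα <;> rw [h'] at hpβ
    · have := Nat.le_of_dvd one_pos hqα
      omega
    · exact hpq ((hp4 hpβ).trans ((Nat.prime_dvd_prime_iff_eq hq Nat.prime_two).1 hqα).symm)
    · exact hpq (((Nat.prime_dvd_prime_iff_eq hp Nat.prime_three).1 hpβ).trans
        ((Nat.prime_dvd_prime_iff_eq hq Nat.prime_three).1 hqα).symm)
    · exact hpq (((Nat.prime_dvd_prime_iff_eq hp Nat.prime_two).1 hpβ).trans (hq4 hqα).symm)
    · have := Nat.le_of_dvd one_pos hpβ
      omega

/-- The arc `(x, y)` has several continuations to closed non-backtracking walks of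
length eight. -/
def Branches (n : ℕ) (j : Fin 2 → ℤ) (x y : Fin 2 × ZMod n) : Prop :=
  ∃ z z', z ≠ z' ∧ IsThird n j x y z ∧ IsThird n j x y z'

lemma Branches.map (φ : GI n 2 j ≃g GI n 2 j) {x y : Fin 2 × ZMod n} (h : Branches n j x y) :
    Branches n j (φ x) (φ y) := by
  obtain ⟨z, z', h, h1, h2⟩ := h
  exact ⟨φ z, φ z', φ.injective.ne h, h1.map φ, h2.map φ⟩

lemma isThird_spoke (hj : ∀ s, (j s : ZMod n) ≠ 0) (s : Fin 2) (v : ZMod n) {w : ZMod n}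
    (hw : w = v + (j (s + 1) : ZMod n) ∨ w = v - (j (s + 1) : ZMod n)) :
    IsThird n j (s, v) (s + 1, v) (s + 1, w) := by
  have hs : s ≠ s + 1 := (by decide : ∀ a : Fin 2, a ≠ a + 1) s
  have hadj : (GI n 2 j).Adj (s + 1, v) (s + 1, w) := by
    rcases hw with rfl | rfl
    · exact adj_layer_add (hj _) _
    · exact adj_layer_sub (hj _) _
  have hadj' : (GI n 2 j).Adj (s + 1, w + (j s : ZMod n)) (s + 1, v + (j s : ZMod n)) := by
    rcases hw with rfl | rfl
    · convert adj_layer_sub (j := j) (hj (s + 1)) _ using 2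
      ring
    · convert adj_layer_add (j := j) (hj (s + 1)) _ using 2
      ring
  refine ⟨(s, w), (s, w + (j s : ZMod n)), (s + 1, w + (j s : ZMod n)),
    (s + 1, v + (j s : ZMod n)), (s, v + (j s : ZMod n)),
    ⟨adj_spoke hs _, hadj, adj_spoke hs.symm _, adj_layer_add (hj s) _, adj_spoke hs _, hadj',
      adj_spoke hs.symm _, (adj_layer_add (hj s) _).symm⟩, ?_⟩
  simp [hs, hs.symm]

lemma branches_spoke (hj : ∀ s, (j s : ZMod n) ≠ 0 ∧ ((2 * j s : ℤ) : ZMod n) ≠ 0) (s : Fin 2)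
    (v : ZMod n) : Branches n j (s, v) (s + 1, v) := by
  refine ⟨_, _, fun h => (hj (s + 1)).2 ?_, isThird_spoke (fun s => (hj s).1) s v (Or.inl rfl),
    isThird_spoke (fun s => (hj s).1) s v (Or.inr rfl)⟩
  have := (Prod.ext_iff.1 h).2
  push_cast
  linear_combination this

lemma preservesLayers_of_branches
    (hj : ∀ s, (j s : ZMod n) ≠ 0 ∧ ((2 * j s : ℤ) : ZMod n) ≠ 0)
    (hvt : IsVertexTransitive (GI n 2 j)) {s : Fin 2}
    (hs : ∀ v y z, y.1 = s → IsThird n j (s, v) y z → z.1 ≠ s) : PreservesLayers n 2 j := by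
  have heq : ∀ a b : Fin 2, a ≠ b → b = a + 1 := by decide
  have hfst : ∀ v y, (GI n 2 j).Adj (s, v) y → Branches n j (s, v) y → y = (s + 1, v) := by
    rintro v y hadj ⟨z, z', hne, hz, hz'⟩
    by_cases hy : y.1 = s
    · refine absurd ?_ hne
      have hspoke : ∀ z, IsThird n j (s, v) y z → z = (s + 1, y.2) := by
        intro z hz
        have h1 := hs v y z hy hz
        obtain ⟨_, _, _, _, _, h, -⟩ := hz
        rcases (adj_iff.1 h.2.1).2 with h | h
        · exact Prod.ext (heq _ _ (Ne.symm h1)) h.1.symm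
        · exact absurd (h.1.symm.trans hy) h1
      rw [hspoke z hz, hspoke z' hz']
    · rcases (adj_iff.1 hadj).2 with h | h
      · exact Prod.ext (heq _ _ (Ne.symm hy)) h.1.symm
      · exact absurd h.1.symm hy
  refine preservesLayers_of_invariant (Branches n j) (fun φ x y h => h.map φ) fun x y hxy => ?_
  constructor
  · intro h hl
    obtain ⟨φ, hφ⟩ := hvt x (s, 0)
    have h1 := hfst 0 (φ y) (hφ ▸ φ.map_adj_iff.2 hxy) (hφ ▸ h.map φ)
    have hsp : x.1 ≠ x.1 + 1 := (by decide : ∀ a : Fin 2, a ≠ a + 1) _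
    have h2 := hfst 0 (φ (x.1 + 1, x.2)) (hφ ▸ φ.map_adj_iff.2 (adj_spoke hsp x.2))
      (hφ ▸ (branches_spoke hj x.1 x.2).map φ)
    have h3 := φ.injective (h1.trans h2.symm)
    rw [h3] at hl
    exact hsp hl
  · intro hne
    rcases (adj_iff.1 hxy).2 with h | h
    · have : y = (x.1 + 1, x.2) := Prod.ext (heq _ _ hne) h.1.symm
      rw [this]
      exact branches_spoke hj x.1 x.2
    · exact absurd h.1 hne

lemma exists_prime_of_not_isUnit (hconn : (GI n 2 j).Connected) (s : Fin 2)
    (hs : ¬ IsUnit (j s : ZMod n)) :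
    ∃ p : ℕ, p.Prime ∧ p ∣ n ∧ (p : ℤ) ∣ j s ∧ ¬ (p : ℤ) ∣ j (s + 1) := by
  rw [ZMod.coe_int_isUnit_iff_isCoprime, Int.isCoprime_iff_gcd_eq_one] at hs
  obtain ⟨p, hp, hpd⟩ := Nat.exists_prime_and_dvd hs
  have hpn : p ∣ n := Int.natCast_dvd_natCast.1
    ((Int.natCast_dvd_natCast.2 hpd).trans (Int.gcd_dvd_left _ _))
  have hps : (p : ℤ) ∣ j s := (Int.natCast_dvd_natCast.2 hpd).trans (Int.gcd_dvd_right _ _)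
  refine ⟨p, hp, hpn, hps, fun hps' => ?_⟩
  have : Fact p.Prime := ⟨hp⟩
  have hall : ∀ i, (p : ℤ) ∣ j i := by
    intro i
    rcases (by decide : ∀ s i : Fin 2, i = s ∨ i = s + 1) s i with rfl | rfl
    · exact hps
    · exact hps'
  have := eq_zero_of_connected hconn (ZMod.castHom hpn (ZMod p)).toAddMonoidHom
    (fun i => by simpa [ZMod.intCast_zmod_eq_zero_iff_dvd] using hall i) 1
  exact one_ne_zero ((map_one (ZMod.castHom hpn (ZMod p))).symm.trans this)

lemma preservesLayers_of_not_isUnit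
    (hj : ∀ s, (j s : ZMod n) ≠ 0 ∧ ((2 * j s : ℤ) : ZMod n) ≠ 0)
    (hconn : (GI n 2 j).Connected) (hvt : IsVertexTransitive (GI n 2 j))
    (hu : ∀ s, ¬ IsUnit (j s : ZMod n)) : PreservesLayers n 2 j := by
  obtain ⟨p, hp, hpn, hp0, hp1⟩ := exists_prime_of_not_isUnit hconn 0 (hu 0)
  obtain ⟨q, hq, hqn, hq1, hq0⟩ := exists_prime_of_not_isUnit hconn 1 (hu 1)
  by_cases h0 : 8 * (j 0 : ZMod n) = 0
  · by_cases h1 : 8 * (j 1 : ZMod n) = 0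
    · have two : ∀ {r : ℕ} {a : ℤ}, r.Prime → r ∣ n → ¬ (r : ℤ) ∣ a →
          8 * (a : ZMod n) = 0 → r = 2 := by
        intro r a hr hrn hra h
        have h' : ((8 * a : ℤ) : ZMod n) = 0 := by exact_mod_cast h
        rw [ZMod.intCast_zmod_eq_zero_iff_dvd] at h'
        have h2 := ((Nat.prime_iff_prime_int.1 hr).dvd_or_dvd
          ((Int.natCast_dvd_natCast.2 hrn).trans h')).resolve_right hra
        have h3 : r ∣ 2 ^ 3 := by exact_mod_cast h2
        exact (Nat.prime_dvd_prime_iff_eq hr Nat.prime_two).1 (hr.dvd_of_dvd_pow h3)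
      rw [two hp hpn hp1 h1] at hp0
      rw [two hq hqn hq0 h0] at hq0
      exact absurd hp0 hq0
    · exact preservesLayers_of_branches hj hvt
        fun v y z hy h => h.fst_ne hq hp hqn hpn hq1 hq0 hp1 hp0 h1 hy
  · exact preservesLayers_of_branches hj hvt
      fun v y z hy h => h.fst_ne hp hq hpn hqn hp0 hp1 hq0 hq1 h0 hy

end TwoLayers

lemma PreservesLayers.hasPrimitiveRoot [NeZero n] (ht : 1 ≤ t) (hP : PreservesLayers n t j)
    (hj : ∀ s, (j s : ZMod n) ≠ 0 ∧ ((2 * j s : ℤ) : ZMod n) ≠ 0)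
    (hconn : (GI n t j).Connected) (hvt : IsVertexTransitive (GI n t j)) :
    HasPrimitiveRoot n t j :=
  have hu := hP.isUnit hj hconn hvt
  (hP.multiplierTransitive hj hu hvt).hasPrimitiveRoot ht hu

lemma hasPrimitiveRoot_of_connected (hn : 3 ≤ n) (ht : 1 ≤ t)
    (hj : ∀ s, (j s : ZMod n) ≠ 0 ∧ ((2 * j s : ℤ) : ZMod n) ≠ 0)
    (hconn : (GI n t j).Connected) (hvt : IsVertexTransitive (GI n t j)) :
    HasPrimitiveRoot n t j := by
  have : NeZero n := ⟨by omega⟩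
  by_cases hall : ∀ s s', (j s : ZMod n) = (j s' : ZMod n) ∨ (j s : ZMod n) = -(j s' : ZMod n)
  · exact hasPrimitiveRoot_of_forall_eq_or_neg ht hconn hall
  rcases (by omega : t = 1 ∨ t = 2 ∨ 3 ≤ t) with rfl | rfl | ht'
  · exact absurd (fun s s' => Or.inl (by rw [Subsingleton.elim s s'])) hall
  · by_cases hu : ∃ s, IsUnit (j s : ZMod n)
    · obtain ⟨s, hs⟩ := hu
      refine hasPrimitiveRoot_of_injective hvt (fun i k hik => ?_) hs
      rw [← not_or]
      intro h
      refine hall fun s s' => ?_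
      rcases (by decide : ∀ i k s s' : Fin 2, i ≠ k → s = s' ∨ (s = i ∧ s' = k) ∨
        (s = k ∧ s' = i)) i k s s' hik with rfl | ⟨rfl, rfl⟩ | ⟨rfl, rfl⟩
      · exact Or.inl rfl
      · exact h
      · exact (layerSetoid n j).symm h
    · push Not at hu
      exact (preservesLayers_of_not_isUnit hj hconn hvt hu).hasPrimitiveRoot ht hj hconn hvt
  · refine (preservesLayers_of_three_mul_ne_zero ht' fun s hs => hall ?_).hasPrimitiveRoot
      ht hj hconn hvt
    exact eq_or_eq_neg_of_three_mul_eq_zero hn hconn (fun s => (hj s).1)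
      (three_mul_eq_zero_of_exists ht' (fun s => (hj s).1) hvt hs)

end GIGraph

/-- in a connected vertex-transitive GI-graph, all elements of `J ∪ -J`
have the same multiplicity `k₀`, and the graph is isomorphic to `GI(n;[k₀]j₀)` for a
primitive `j₀` with `GI(n;j₀)` vertex-transitive. -/
theorem GI_vt_structure (n t : ℕ) (hn : 3 ≤ n) (ht : 1 ≤ t) (j : Fin t → ℤ)
    (hj : ∀ s, (j s : ZMod n) ≠ 0 ∧ ((2 * j s : ℤ) : ZMod n) ≠ 0)
    (hconn : (GI n t j).Connected) (hvt : IsVertexTransitive (GI n t j)) :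
    ∃ k₀ : ℕ, 1 ≤ k₀ ∧
      (∀ s : Fin t,
        (Finset.univ.filter (fun i => (j i : ZMod n) = (j s : ZMod n) ∨
          (j i : ZMod n) = -((j s : ZMod n)))).card = k₀) ∧
      ∃ t₀ : ℕ, ∃ j₀ : Fin t₀ → ℤ, t = k₀ * t₀ ∧ PrimitiveSeq n j₀ ∧
        IsVertexTransitive (GI n t₀ j₀) ∧
        Nonempty (GI n t j ≃g GI n (k₀ * t₀) (rep k₀ t₀ j₀)) := by
  exact GIGraph.hasPrimitiveRoot_of_connected hn ht hj hconn hvt
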